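/- Let μ be a long positive root of Δ and let w_μ be the unique element of minimal length in W with w_μ(θ) = μ. Then N(w_μ⁻¹) = {γ ∈ Δ⁺ : (γ, μ∨) = −1}. In particular, #{γ ∈ Δ⁺ : (γ, μ∨) = −1} = (ρ, θ∨ − μ∨). -/

import Mathlib

open scoped BigOperators

/-- Data of a reduced irreducible crystallographic root system `Δ`, spanning a
`ℚ`-vector space `V` equipped with a Weyl-group-invariant inner product `B`,
together with a chosen system of positive roots `Pos` and the highest root `θ`. -/
structure RootSystemCtx (V : Type*) [AddCommGroup V] [Module ℚ V] where
  /-- the invariant inner product `( , )` -/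
  B : V →ₗ[ℚ] V →ₗ[ℚ] ℚ
  B_symm : ∀ x y : V, B x y = B y x
  B_posdef : ∀ x : V, x ≠ 0 → 0 < B x x
  /-- the set of roots -/
  Δ : Set V
  Δ_finite : Δ.Finite
  Δ_spans : Submodule.span ℚ Δ = ⊤
  zero_notMem_Δ : (0 : V) ∉ Δ
  neg_mem_Δ : ∀ α ∈ Δ, -α ∈ Δ
  reduced : ∀ α ∈ Δ, ∀ c : ℚ, c • α ∈ Δ → c = 1 ∨ c = -1
  crystallographic : ∀ α ∈ Δ, ∀ β ∈ Δ, ∃ n : ℤ, 2 * B α β / B β β = (n : ℚ)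
  reflect_mem : ∀ α ∈ Δ, ∀ β ∈ Δ, β - (2 * B β α / B α α) • α ∈ Δ
  irreducible : ∀ S : Set V, S ⊆ Δ → (∀ α ∈ S, ∀ β ∈ Δ \ S, B α β = 0) → S = ∅ ∨ S = Δ
  /-- the positive roots `Δ⁺` -/
  Pos : Set V
  pos_subset : Pos ⊆ Δ
  mem_pos_or_neg_pos : ∀ α ∈ Δ, α ∈ Pos ∨ -α ∈ Pos
  pos_not_neg : ∀ α ∈ Pos, -α ∉ Pos
  add_pos_mem : ∀ α ∈ Pos, ∀ β ∈ Pos, α + β ∈ Δ → α + β ∈ Pos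
  /-- the highest root `θ` -/
  θ : V
  θ_pos : θ ∈ Pos
  θ_highest : ∀ ν ∈ Δ, θ - ν ∈ AddSubmonoid.closure Pos

namespace RootSystemCtx

variable {V : Type*} [AddCommGroup V] [Module ℚ V] (ctx : RootSystemCtx V)

/-- the simple roots `Π`: indecomposable positive roots -/
def simple : Set V :=
  {α | α ∈ ctx.Pos ∧ ¬∃ β ∈ ctx.Pos, ∃ γ ∈ ctx.Pos, α = β + γ}

/-- `ρ`, the half-sum of all positive roots -/
noncomputable def ρ : V :=
  (1 / 2 : ℚ) • ∑ α ∈ (ctx.Δ_finite.subset ctx.pos_subset).toFinset, α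

/-- the coroot `μ∨ = 2μ/(μ,μ)` -/
noncomputable def coroot (μ : V) : V := (2 / ctx.B μ μ) • μ

/-- `Δ⁺_l`, the long positive roots (roots of the same length as `θ`) -/
def PosLong : Set V := {μ | μ ∈ ctx.Pos ∧ ctx.B μ μ = ctx.B ctx.θ ctx.θ}

/-- `Π_l`, the long simple roots -/
def SimpleLong : Set V := {μ | μ ∈ ctx.simple ∧ ctx.B μ μ = ctx.B ctx.θ ctx.θ}

/-- the dominance order `μ ≼ ν` on the root lattice: `ν - μ` is a nonnegative
integer combination of positive roots -/
def le (μ ν : V) : Prop := ν - μ ∈ AddSubmonoid.closure ctx.Pos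

/-- a (combinatorial) abelian ideal of `Δ⁺` -/
def IsAbelianIdeal (I : Set V) : Prop :=
  I ⊆ ctx.Pos ∧ (∀ μ ∈ I, ∀ ν ∈ I, μ + ν ∉ ctx.Δ) ∧
    ∀ γ ∈ I, ∀ ν ∈ ctx.Pos, γ + ν ∈ ctx.Δ → γ + ν ∈ I

/-- `γ` is a generator of the ideal `I` -/
def IsGenerator (I : Set V) (γ : V) : Prop := γ ∈ I ∧ ∀ α ∈ ctx.Pos, γ - α ∉ I

/-! ### The affine picture: `V̂ = V ⊕ ℚδ ⊕ ℚλ`, modelled as `V × ℚ × ℚ`,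
with `δ = (0,1,0)` and `λ = (0,0,1)`. -/

/-- the embedding of `V` into `V̂` -/
def emb (_ctx : RootSystemCtx V) (v : V) : V × ℚ × ℚ := (v, 0, 0)

/-- the imaginary root `δ` -/
def δhat (_ctx : RootSystemCtx V) : V × ℚ × ℚ := (0, 1, 0)

/-- the affine simple root `α₀ = δ - θ` -/
def alpha0 : V × ℚ × ℚ := (-ctx.θ, 1, 0)

/-- the extension of the inner product to `V̂`, with
`(δ,V)=(λ,V)=(δ,δ)=(λ,λ)=0` and `(δ,λ)=1` -/
noncomputable def Bhat : (V × ℚ × ℚ) →ₗ[ℚ] (V × ℚ × ℚ) →ₗ[ℚ] ℚ :=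
  LinearMap.mk₂ ℚ (fun x y => ctx.B x.1 y.1 + x.2.1 * y.2.2 + x.2.2 * y.2.1)
    (fun x x' y => by
      simp only [Prod.fst_add, Prod.snd_add, map_add, LinearMap.add_apply]; ring)
    (fun c x y => by
      simp only [Prod.smul_fst, Prod.smul_snd, map_smul, LinearMap.smul_apply,
        smul_eq_mul]; ring)
    (fun x y y' => by
      simp only [Prod.fst_add, Prod.snd_add, map_add]; ring)
    (fun c x y => by
      simp only [Prod.smul_fst, Prod.smul_snd, map_smul, smul_eq_mul]; ring)

/-- the set `Δ̂` of affine real roots -/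
def Δhat : Set (V × ℚ × ℚ) := {x | ∃ α ∈ ctx.Δ, ∃ k : ℤ, x = (α, (k : ℚ), 0)}

/-- the set `Δ̂⁺` of positive affine roots -/
def PosHat : Set (V × ℚ × ℚ) :=
  {x | ∃ α ∈ ctx.Pos, x = (α, 0, 0)} ∪
    {x | ∃ α ∈ ctx.Δ, ∃ k : ℤ, 1 ≤ k ∧ x = (α, (k : ℚ), 0)}

/-- the set `Π̂ = Π ∪ {α₀}` of affine simple roots -/
def SimpleHat : Set (V × ℚ × ℚ) :=
  {x | ∃ α ∈ ctx.simple, x = (α, (0 : ℚ), (0 : ℚ))} ∪ {ctx.alpha0}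

/-- the reflection `s_β : x ↦ x − (2(x,β)/(β,β))·β` in `V̂` -/
noncomputable def refl (β : V × ℚ × ℚ) : (V × ℚ × ℚ) ≃ₗ[ℚ] (V × ℚ × ℚ) :=
  if h : ctx.Bhat β β = 0 then LinearEquiv.refl ℚ _
  else
    Module.reflection (x := β) (f := (2 / ctx.Bhat β β) • ctx.Bhat β)
      (by simp only [LinearMap.smul_apply, smul_eq_mul]; field_simp)

/-- the affine Weyl group `Ŵ`, generated by the reflections `s_β`, `β ∈ Δ̂` -/
def What : Subgroup ((V × ℚ × ℚ) ≃ₗ[ℚ] (V × ℚ × ℚ)) :=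
  Subgroup.closure {g | ∃ β ∈ ctx.Δhat, g = ctx.refl β}

/-- the finite Weyl group `W`, generated by the reflections `s_α`, `α ∈ Δ`
(identified with a subgroup of `Ŵ`) -/
def Wfin : Subgroup ((V × ℚ × ℚ) ≃ₗ[ℚ] (V × ℚ × ℚ)) :=
  Subgroup.closure {g | ∃ α ∈ ctx.Δ, g = ctx.refl (α, (0 : ℚ), (0 : ℚ))}

/-- `N̂(w) = {β ∈ Δ̂⁺ : w(β) ∈ −Δ̂⁺}` -/
def Nhat (w : (V × ℚ × ℚ) ≃ₗ[ℚ] (V × ℚ × ℚ)) : Set (V × ℚ × ℚ) :=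
  {β | β ∈ ctx.PosHat ∧ -(w β) ∈ ctx.PosHat}

/-- a minuscule element of `Ŵ`: every element of `N̂(w)` has the form `δ - γ`
with `γ ∈ Δ⁺` -/
def IsMinuscule (w : (V × ℚ × ℚ) ≃ₗ[ℚ] (V × ℚ × ℚ)) : Prop :=
  w ∈ ctx.What ∧ ∀ β ∈ ctx.Nhat w, ∃ γ ∈ ctx.Pos, β = ctx.δhat - ctx.emb γ

/-- the abelian ideal `I_w` corresponding to a minuscule element `w` -/
def idealOf (w : (V × ℚ × ℚ) ≃ₗ[ℚ] (V × ℚ × ℚ)) : Set V :=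
  {γ | γ ∈ ctx.Pos ∧ ctx.δhat - ctx.emb γ ∈ ctx.Nhat w}

/-- the ideal `I` has rootlet `τ(I) = μ`, i.e. `I = I_w` for some minuscule `w`
with `w(α₀) + δ = μ` -/
def HasRootlet (I : Set V) (μ : V) : Prop :=
  ∃ w, ctx.IsMinuscule w ∧ ctx.idealOf w = I ∧ w ctx.alpha0 + ctx.δhat = ctx.emb μ

/-- `Ab_μ`, the set of nonempty abelian ideals with rootlet `μ` -/
def AbFiber (μ : V) : Set (Set V) := {I | I.Nonempty ∧ ctx.HasRootlet I μ}

/-- `N(u) = {γ ∈ Δ⁺ : u(γ) ∈ −Δ⁺}` for `u` in the finite Weyl group -/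
def Nfin (w : (V × ℚ × ℚ) ≃ₗ[ℚ] (V × ℚ × ℚ)) : Set V :=
  {γ | γ ∈ ctx.Pos ∧ -(w (ctx.emb γ)) ∈ ctx.PosHat}

/-- the length `l(u) = #N(u)` of an element of the finite Weyl group -/
noncomputable def lenFin (w : (V × ℚ × ℚ) ≃ₗ[ℚ] (V × ℚ × ℚ)) : ℕ :=
  (ctx.Nfin w).ncard

end RootSystemCtx

namespace RootSystemCtx

variable {V : Type*} [AddCommGroup V] [Module ℚ V] (ctx : RootSystemCtx V)

lemma ne_zero_of_mem {α : V} (h : α ∈ ctx.Δ) : α ≠ 0 := fun h0 => ctx.zero_notMem_Δ (h0 ▸ h)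

lemma B_self_pos {α : V} (h : α ∈ ctx.Δ) : 0 < ctx.B α α :=
  ctx.B_posdef α (ctx.ne_zero_of_mem h)

lemma B_add_self (x y : V) :
    ctx.B (x + y) (x + y) = ctx.B x x + 2 * ctx.B x y + ctx.B y y := by
  simp only [map_add, LinearMap.add_apply, ctx.B_symm y x]; ring

lemma eq_zero_of_B_self_nonpos {x : V} (h : ctx.B x x ≤ 0) : x = 0 := by
  by_contra hx
  exact absurd (ctx.B_posdef x hx) (not_lt.mpr h)

lemma neg_mem_pos {α : V} (h : α ∈ ctx.Δ) (h' : α ∉ ctx.Pos) : -α ∈ ctx.Pos :=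
  (ctx.mem_pos_or_neg_pos α h).resolve_left h'

/-- If the Cartan integer of `β` along `α` is negative and is not `-1`, then it is at most `-2`. -/
lemma add_mem_or_B_self_le {α β : V} (hα : α ∈ ctx.Δ) (hβ : β ∈ ctx.Δ) (h : ctx.B β α < 0) :
    2 * ctx.B β α / ctx.B α α = -1 ∨ ctx.B α α ≤ -ctx.B β α := by
  have hp := ctx.B_self_pos hα
  obtain ⟨n, hn⟩ := ctx.crystallographic β hβ α hα
  rw [div_eq_iff hp.ne'] at hn
  have hn0 : n < 0 := by
    by_contra! h0
    have : (0 : ℚ) ≤ n := by exact_mod_cast h0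
    nlinarith
  rcases (by omega : n = -1 ∨ n ≤ -2) with rfl | h2
  · left
    rw [div_eq_iff hp.ne', hn]; push_cast; ring
  · right
    have : (n : ℚ) ≤ -2 := by exact_mod_cast h2
    nlinarith

lemma add_mem_of_B_neg {α β : V} (hα : α ∈ ctx.Δ) (hβ : β ∈ ctx.Δ) (h : ctx.B α β < 0)
    (h0 : α + β ≠ 0) : α + β ∈ ctx.Δ := by
  have h' : ctx.B β α < 0 := ctx.B_symm α β ▸ h
  rcases ctx.add_mem_or_B_self_le hα hβ h' with h1 | h1
  · have := ctx.reflect_mem α hα β hβ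
    rw [h1] at this
    simpa [add_comm] using this
  rcases ctx.add_mem_or_B_self_le hβ hα h with h2 | h2
  · have := ctx.reflect_mem β hβ α hα
    rw [h2] at this
    simpa using this
  · refine absurd (ctx.eq_zero_of_B_self_nonpos ?_) h0
    rw [B_add_self]
    rw [ctx.B_symm β α] at h1
    linarith

lemma sum_pos_ne_zero (n : ℕ) (s : Multiset V) (hn : s.card = n + 1)
    (hs : ∀ α ∈ s, α ∈ ctx.Pos) : s.sum ≠ 0 := by
  induction n generalizing s with
  | zero =>
    obtain ⟨α, rfl⟩ := Multiset.card_eq_one.mp hn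
    simpa using ctx.ne_zero_of_mem (ctx.pos_subset (hs α (by simp)))
  | succ n ih =>
    intro h0
    obtain ⟨α, t, rfl⟩ := Multiset.card_pos_iff_exists_mem.mp (by omega : 0 < s.card) |>.imp
      fun α h => Multiset.exists_cons_of_mem h
    have hα := hs α (by simp)
    rw [Multiset.sum_cons] at h0
    obtain ⟨β, hβt, hβ⟩ : ∃ β ∈ t, ctx.B α β < 0 := by
      by_contra! hc
      have h1 : ctx.B α t.sum = (t.map (ctx.B α)).sum := map_multiset_sum _ _
      have h2 : 0 ≤ (t.map (ctx.B α)).sum := Multiset.sum_nonneg (by simpa using hc)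
      have h3 : t.sum = -α := (neg_eq_of_add_eq_zero_right h0).symm
      rw [h3, map_neg] at h1
      linarith [ctx.B_self_pos (ctx.pos_subset hα)]
    obtain ⟨t, rfl⟩ := Multiset.exists_cons_of_mem hβt
    have hβp := hs β (by simp)
    have hne : α + β ≠ 0 := fun h => ctx.pos_not_neg α hα (by
      rw [neg_eq_of_add_eq_zero_right h]; exact hβp)
    have hαβ := ctx.add_pos_mem α hα β hβp
      (ctx.add_mem_of_B_neg (ctx.pos_subset hα) (ctx.pos_subset hβp) hβ hne)
    refine ih ((α + β) ::ₘ t) (by simpa using hn) ?_ ?_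
    · intro γ hγ
      rcases Multiset.mem_cons.mp hγ with rfl | hγ
      · exact hαβ
      · exact hs γ (by simp [hγ])
    · simpa [add_assoc] using h0

lemma add_closure_ne_zero {α x : V} (hα : α ∈ ctx.Pos) (hx : x ∈ AddSubmonoid.closure ctx.Pos) :
    α + x ≠ 0 := by
  obtain ⟨s, hs, rfl⟩ := AddSubmonoid.exists_multiset_of_mem_closure hx
  have := ctx.sum_pos_ne_zero s.card (α ::ₘ s) (by simp) (by simpa [hα] using hs)
  simpa using this

lemma mem_pos_of_mem_closure {x : V} (h : x ∈ ctx.Δ) (hx : x ∈ AddSubmonoid.closure ctx.Pos) :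
    x ∈ ctx.Pos := by
  by_contra hc
  exact ctx.add_closure_ne_zero (ctx.neg_mem_pos h hc) hx (by simp)

/-- The reflection of `β` in `α` subtracts an integer multiple of `α`. -/
lemma exists_reflect_eq {α β : V} (hα : α ∈ ctx.Δ) (hβ : β ∈ ctx.Δ) :
    ∃ n : ℤ, 2 * ctx.B β α / ctx.B α α = n ∧ β - n • α ∈ ctx.Δ := by
  obtain ⟨n, hn⟩ := ctx.crystallographic β hβ α hα
  have := ctx.reflect_mem α hα β hβ
  rw [hn, Int.cast_smul_eq_zsmul] at this
  exact ⟨n, hn, this⟩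

lemma cartan_neg {α β : V} {n : ℤ} (hα : α ∈ ctx.Δ)
    (hn : 2 * ctx.B β α / ctx.B α α = n) (h : ctx.B β α < 0) : n < 0 := by
  have : (n : ℚ) < 0 := by
    rw [← hn]; exact div_neg_of_neg_of_pos (by linarith) (ctx.B_self_pos hα)
  exact_mod_cast this

lemma theta_dominant {γ : V} (hγ : γ ∈ ctx.Pos) : 0 ≤ ctx.B γ ctx.θ := by
  by_contra! h
  rw [ctx.B_symm] at h
  obtain ⟨n, hn, hr⟩ := ctx.exists_reflect_eq (ctx.pos_subset hγ) (ctx.pos_subset ctx.θ_pos)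
  have hn0 := ctx.cartan_neg (ctx.pos_subset hγ) hn h
  have h1 := ctx.θ_highest _ hr
  obtain ⟨k, rfl⟩ : ∃ k : ℕ, n = -(k + 1 : ℤ) := ⟨(-n - 1).toNat, by omega⟩
  refine ctx.add_closure_ne_zero hγ (add_mem
    (AddSubmonoid.nsmul_mem _ (AddSubmonoid.subset_closure hγ) k) h1) ?_
  rw [neg_smul, add_smul, natCast_zsmul, one_smul]
  abel

/-- Every root has the same length as some dominant root. -/
lemma exists_dominant_of_length {γ : V} (hγ : γ ∈ ctx.Δ) :
    ∃ ν ∈ ctx.Δ, ctx.B ν ν = ctx.B γ γ ∧ ∀ α ∈ ctx.Pos, 0 ≤ ctx.B ν α := by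
  let below : V → Set V := fun ν => {x | x ∈ ctx.Δ ∧ ν - x ∈ AddSubmonoid.closure ctx.Pos}
  have hfin : {ν | ν ∈ ctx.Δ ∧ ctx.B ν ν = ctx.B γ γ}.Finite :=
    ctx.Δ_finite.subset fun _ h => h.1
  obtain ⟨ν, ⟨hν, hlen⟩, hmax⟩ := Set.exists_max_image _ (fun ν => (below ν).ncard) hfin
    ⟨γ, hγ, rfl⟩
  refine ⟨ν, hν, hlen, fun α hα => ?_⟩
  by_contra! h
  have hαΔ := ctx.pos_subset hα
  obtain ⟨n, hn, hr⟩ := ctx.exists_reflect_eq hαΔ hν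
  have hn0 := ctx.cartan_neg hαΔ hn h
  obtain ⟨k, rfl⟩ : ∃ k : ℕ, n = -(k + 1 : ℤ) := ⟨(-n - 1).toNat, by omega⟩
  have hk := AddSubmonoid.nsmul_mem _ (AddSubmonoid.subset_closure hα) k
  have hk1 := AddSubmonoid.nsmul_mem _ (AddSubmonoid.subset_closure hα) (k + 1)
  have hν' : ν - (-(k + 1 : ℤ)) • α = ν + (k + 1) • α := by
    rw [neg_smul, sub_neg_eq_add, ← natCast_zsmul]; push_cast; rfl
  rw [hν'] at hr
  refine absurd (hmax (ν + (k + 1) • α) ⟨hr, ?_⟩) (not_le.mpr ?_)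
  · rw [← hlen, ← hν']
    rw [div_eq_iff (ctx.B_self_pos hαΔ).ne'] at hn
    rw [← Int.cast_smul_eq_zsmul ℚ]
    simp only [map_sub, LinearMap.sub_apply, map_smul, LinearMap.smul_apply, smul_eq_mul,
      ctx.B_symm α ν]
    generalize ((-(k + 1 : ℤ) : ℤ) : ℚ) = c at hn ⊢
    linear_combination (-c) * hn
  · refine Set.ncard_lt_ncard ?_ (ctx.Δ_finite.subset fun _ h => h.1)
    refine ⟨fun x hx => ⟨hx.1, ?_⟩, fun hsub => ?_⟩
    · have := add_mem hx.2 hk1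
      rwa [show ν + (k + 1) • α - x = ν - x + (k + 1) • α by abel]
    · have := (hsub ⟨hr, by simp [zero_mem]⟩ : ν + (k + 1) • α ∈ below ν).2
      refine ctx.add_closure_ne_zero hα (add_mem hk this) ?_
      rw [succ_nsmul]
      abel

lemma B_nonneg_of_mem_closure {ν x : V} (hν : ∀ α ∈ ctx.Pos, 0 ≤ ctx.B ν α)
    (hx : x ∈ AddSubmonoid.closure ctx.Pos) : 0 ≤ ctx.B ν x := by
  induction hx using AddSubmonoid.closure_induction with
  | mem x h => exact hν x h
  | zero => simp
  | add x y _ _ hx hy => rw [map_add]; exact add_nonneg hx hy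

lemma B_self_le_theta {γ : V} (hγ : γ ∈ ctx.Δ) : ctx.B γ γ ≤ ctx.B ctx.θ ctx.θ := by
  obtain ⟨ν, hν, hlen, hdom⟩ := ctx.exists_dominant_of_length hγ
  have h := ctx.θ_highest ν hν
  have h1 := ctx.B_nonneg_of_mem_closure hdom h
  have h2 := ctx.B_nonneg_of_mem_closure
    (fun α hα => ctx.B_symm α ctx.θ ▸ ctx.theta_dominant hα) h
  rw [map_sub] at h1 h2
  rw [ctx.B_symm ν ctx.θ] at h1
  linarith

lemma B_coroot (γ μ : V) : ctx.B γ (ctx.coroot μ) = 2 * ctx.B γ μ / ctx.B μ μ := by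
  simp only [coroot, map_smul, smul_eq_mul]; ring

lemma B_coroot_eq_neg_one_iff {γ μ : V} (hγ : γ ∈ ctx.Pos) (hμ : μ ∈ ctx.PosLong) :
    ctx.B γ (ctx.coroot μ) = -1 ↔ ctx.B γ μ < 0 := by
  have hμΔ := ctx.pos_subset hμ.1
  have hp := ctx.B_self_pos hμΔ
  rw [B_coroot]
  refine ⟨fun h => ?_, fun h => ?_⟩
  · rw [div_eq_iff hp.ne'] at h; linarith
  · refine (ctx.add_mem_or_B_self_le hμΔ (ctx.pos_subset hγ) h).resolve_right fun hle => ?_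
    have hlong := ctx.B_self_le_theta (ctx.pos_subset hγ)
    rw [← hμ.2] at hlong
    have h0 : γ + μ = 0 := ctx.eq_zero_of_B_self_nonpos (by rw [B_add_self]; linarith)
    exact ctx.pos_not_neg γ hγ (by rw [neg_eq_of_add_eq_zero_right h0]; exact hμ.1)

/-- Linear isometries of `V` which permute the roots. -/
structure IsRootIsometry (e : V ≃ₗ[ℚ] V) : Prop where
  isometry : ∀ x y, ctx.B (e x) (e y) = ctx.B x y
  map_mem_iff : ∀ x, e x ∈ ctx.Δ ↔ x ∈ ctx.Δ

lemma IsRootIsometry.symm {e : V ≃ₗ[ℚ] V} (he : ctx.IsRootIsometry e) :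
    ctx.IsRootIsometry e.symm where
  isometry x y := by rw [← he.isometry]; simp
  map_mem_iff x := by rw [← he.map_mem_iff]; simp

lemma refl_emb {α : V} (hα : α ∈ ctx.Δ) (v : V) :
    ctx.refl (α, 0, 0) (ctx.emb v) =
      ctx.emb (v - (2 * ctx.B v α / ctx.B α α) • α) := by
  have h : ctx.Bhat (α, 0, 0) (α, 0, 0) = ctx.B α α := by simp [Bhat]
  rw [refl, dif_neg (by rw [h]; exact (ctx.B_self_pos hα).ne'), Module.reflection_apply]
  simp [Bhat, emb, ctx.B_symm α v]
  ring_nf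
  exact ⟨trivial, rfl⟩

/-- The reflection in a root `α`, acting on `V`. -/
noncomputable def rootReflection {α : V} (hα : α ∈ ctx.Δ) : V ≃ₗ[ℚ] V :=
  Module.reflection (x := α) (f := (2 / ctx.B α α) • ctx.B α) (by
    have := (ctx.B_self_pos hα).ne'
    simp only [LinearMap.smul_apply, smul_eq_mul]; field_simp)

lemma rootReflection_apply {α : V} (hα : α ∈ ctx.Δ) (v : V) :
    ctx.rootReflection hα v = v - (2 * ctx.B v α / ctx.B α α) • α := by
  rw [rootReflection, Module.reflection_apply]
  simp only [LinearMap.smul_apply, smul_eq_mul, ctx.B_symm α v]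
  congr 2; ring

lemma rootReflection_rootReflection {α : V} (hα : α ∈ ctx.Δ) (v : V) :
    ctx.rootReflection hα (ctx.rootReflection hα v) = v :=
  Module.involutive_reflection _ v

lemma rootReflection_mem {α : V} (hα : α ∈ ctx.Δ) {v : V} (hv : v ∈ ctx.Δ) :
    ctx.rootReflection hα v ∈ ctx.Δ := by
  rw [rootReflection_apply]; exact ctx.reflect_mem α hα v hv

lemma isRootIsometry_rootReflection {α : V} (hα : α ∈ ctx.Δ) :
    ctx.IsRootIsometry (ctx.rootReflection hα) where
  isometry x y := by
    have := (ctx.B_self_pos hα).ne'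
    simp only [rootReflection_apply, map_sub, LinearMap.sub_apply, map_smul,
      LinearMap.smul_apply, smul_eq_mul, ctx.B_symm α]
    field_simp
    ring
  map_mem_iff x := ⟨fun h => by
    simpa only [rootReflection_rootReflection] using ctx.rootReflection_mem hα h,
    ctx.rootReflection_mem hα⟩

lemma exists_isometry_of_mem_Wfin {w : (V × ℚ × ℚ) ≃ₗ[ℚ] (V × ℚ × ℚ)} (hw : w ∈ ctx.Wfin) :
    ∃ e : V ≃ₗ[ℚ] V, ctx.IsRootIsometry e ∧ ∀ v, w (ctx.emb v) = ctx.emb (e v) := by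
  induction hw using Subgroup.closure_induction with
  | mem w h =>
    obtain ⟨α, hα, rfl⟩ := h
    exact ⟨ctx.rootReflection hα, ctx.isRootIsometry_rootReflection hα, fun v => by
      rw [ctx.refl_emb hα, rootReflection_apply]⟩
  | one => exact ⟨LinearEquiv.refl ℚ V, ⟨fun _ _ => rfl, fun _ => Iff.rfl⟩, fun _ => rfl⟩
  | mul w₁ w₂ _ _ h₁ h₂ =>
    obtain ⟨e₁, he₁, h₁⟩ := h₁
    obtain ⟨e₂, he₂, h₂⟩ := h₂
    refine ⟨e₂.trans e₁, ⟨fun x y => ?_, fun x => ?_⟩, fun v => ?_⟩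
    · simp [he₁.isometry, he₂.isometry]
    · simp [he₁.map_mem_iff, he₂.map_mem_iff]
    · simp [LinearEquiv.mul_apply, h₁, h₂]
  | inv w _ h =>
    obtain ⟨e, he, h⟩ := h
    exact ⟨e.symm, he.symm, fun v => w.injective (by
      rw [h, e.apply_symm_apply]; exact w.apply_symm_apply _)⟩

lemma inv_emb {w : (V × ℚ × ℚ) ≃ₗ[ℚ] (V × ℚ × ℚ)} {e : V ≃ₗ[ℚ] V}
    (h : ∀ v, w (ctx.emb v) = ctx.emb (e v)) (v : V) :
    w⁻¹ (ctx.emb v) = ctx.emb (e.symm v) :=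
  w.injective (by rw [h, e.apply_symm_apply]; exact w.apply_symm_apply _)

lemma neg_emb_mem_PosHat_iff (v : V) : -(ctx.emb v) ∈ ctx.PosHat ↔ -v ∈ ctx.Pos := by
  simp only [PosHat, emb, Set.mem_union, Set.mem_ofPred_eq, Prod.neg_mk, Prod.mk.injEq, neg_zero]
  constructor
  · rintro (⟨α, hα, rfl, -⟩ | ⟨α, -, k, hk, -, h, -⟩)
    · exact hα
    · have : k = 0 := by exact_mod_cast h.symm
      omega
  · exact fun h => Or.inl ⟨_, h, rfl, trivial⟩

lemma Nfin_eq {w : (V × ℚ × ℚ) ≃ₗ[ℚ] (V × ℚ × ℚ)} {e : V → V}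
    (h : ∀ v, w (ctx.emb v) = ctx.emb (e v)) :
    ctx.Nfin w = {γ | γ ∈ ctx.Pos ∧ -(e γ) ∈ ctx.Pos} := by
  ext γ
  simp only [Nfin, Set.mem_ofPred_eq, h, neg_emb_mem_PosHat_iff]

/-- Multiplying on the right by a reflection in an inversion strictly decreases the number of
inversions. -/
lemma ncard_inversions_lt {e : V ≃ₗ[ℚ] V} (he : ctx.IsRootIsometry e) {β : V} (hβ : β ∈ ctx.Pos)
    (heβ : -(e β) ∈ ctx.Pos) :
    {γ | γ ∈ ctx.Pos ∧ -(e (ctx.rootReflection (ctx.pos_subset hβ) γ)) ∈ ctx.Pos}.ncard <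
      {γ | γ ∈ ctx.Pos ∧ -(e γ) ∈ ctx.Pos}.ncard := by
  classical
  have hβΔ := ctx.pos_subset hβ
  set s := ctx.rootReflection hβΔ with hs
  have hss : ∀ x, s (s x) = x := ctx.rootReflection_rootReflection hβΔ
  have hsβ : s β = -β := by
    have := (ctx.B_self_pos hβΔ).ne'
    rw [hs, rootReflection_apply, mul_div_assoc, div_self this, mul_one, two_smul]; abel
  have hfin : {γ | γ ∈ ctx.Pos ∧ -(e γ) ∈ ctx.Pos}.Finite :=
    ctx.Δ_finite.subset fun _ h => ctx.pos_subset h.1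
  let f : V → V := fun x => if s x ∈ ctx.Pos then s x else x
  set A := {γ | γ ∈ ctx.Pos ∧ -(e (s γ)) ∈ ctx.Pos}
  have hinj : Set.InjOn f A := by
    intro x hx y hy hxy
    simp only [f] at hxy
    split_ifs at hxy with h1 h2 h2
    · exact s.injective hxy
    · exact absurd (by rw [← hxy, hss]; exact hx.1) h2
    · exact absurd (by rw [hxy, hss]; exact hy.1) h1
    · exact hxy
  rw [← hinj.ncard_image]
  refine Set.ncard_lt_ncard ⟨?_, fun hsub => ?_⟩ hfin
  · rintro _ ⟨x, hx, rfl⟩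
    simp only [f]
    split_ifs with h1
    · exact ⟨h1, hx.2⟩
    · refine ⟨hx.1, ?_⟩
      have hxΔ := ctx.pos_subset hx.1
      have hneg := ctx.neg_mem_pos (ctx.rootReflection_mem hβΔ hxΔ) h1
      obtain ⟨n, hn, -⟩ := ctx.exists_reflect_eq hβΔ hxΔ
      have hsx : s x = x - n • β := by
        rw [hs, rootReflection_apply, hn, Int.cast_smul_eq_zsmul]
      have hn0 : 0 ≤ n := by
        by_contra! hlt
        obtain ⟨k, rfl⟩ : ∃ k : ℕ, n = -(k : ℤ) := ⟨(-n).toNat, by omega⟩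
        refine ctx.add_closure_ne_zero hneg (add_mem (AddSubmonoid.subset_closure hx.1)
          (AddSubmonoid.nsmul_mem _ (AddSubmonoid.subset_closure hβ) k)) ?_
        rw [← hs, hsx, neg_smul, natCast_zsmul]; abel
      obtain ⟨k, rfl⟩ := Int.eq_ofNat_of_zero_le hn0
      refine ctx.mem_pos_of_mem_closure
        (ctx.neg_mem_Δ _ ((he.map_mem_iff x).mpr hxΔ)) ?_
      have := add_mem (AddSubmonoid.subset_closure hx.2)
        (AddSubmonoid.nsmul_mem _ (AddSubmonoid.subset_closure heβ) k)
      rw [hsx, natCast_zsmul, map_sub, map_nsmul, smul_neg] at this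
      convert this using 1
      abel
  · obtain ⟨x, hx, hfx⟩ := hsub ⟨hβ, heβ⟩
    simp only [f] at hfx
    split_ifs at hfx with h1
    · have hxβ : x = -β := by rw [← hss x, hfx, hsβ]
      exact ctx.pos_not_neg β hβ (hxβ ▸ hx.1)
    · have h2 := hx.2
      rw [hfx, hsβ, map_neg] at h2
      exact ctx.pos_not_neg _ heβ h2

/-- The sum over the positive roots of an odd function, twisted by a root isometry, changes by
its contributions at the inversions. -/
lemma sum_pos_comp {e : V ≃ₗ[ℚ] V} (he : ctx.IsRootIsometry e) (f : V →ₗ[ℚ] ℚ) :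
    ∑ γ ∈ (ctx.Δ_finite.subset ctx.pos_subset).toFinset, f (e γ) =
      ∑ γ ∈ (ctx.Δ_finite.subset ctx.pos_subset).toFinset, f γ +
        ∑ᶠ γ ∈ {γ | γ ∈ ctx.Pos ∧ -(e γ) ∈ ctx.Pos}, 2 * f (e γ) := by
  classical
  set P := (ctx.Δ_finite.subset ctx.pos_subset).toFinset
  have hP : ∀ x, x ∈ P ↔ x ∈ ctx.Pos := fun x => Set.Finite.mem_toFinset _
  let a : V → V := fun x => if x ∈ ctx.Pos then x else -x
  have ha : ∀ x ∈ ctx.Δ, a x ∈ ctx.Pos := by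
    intro x hx
    simp only [a]
    split_ifs with h
    · exact h
    · exact ctx.neg_mem_pos hx h
  have hmaps : ∀ γ ∈ P, a (e γ) ∈ P := fun γ hγ => (hP _).mpr
    (ha _ ((he.map_mem_iff γ).mpr (ctx.pos_subset ((hP γ).mp hγ))))
  have hinj : Set.InjOn (fun γ => a (e γ)) P := by
    intro x hx y hy hxy
    have hx := (hP x).mp hx
    have hy := (hP y).mp hy
    simp only [a] at hxy
    split_ifs at hxy
    · exact e.injective hxy
    · rw [← map_neg] at hxy
      exact absurd (e.injective hxy ▸ hx) (ctx.pos_not_neg y hy)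
    · rw [← map_neg] at hxy
      exact absurd (e.injective hxy ▸ hy) (ctx.pos_not_neg x hx)
    · exact e.injective (neg_injective hxy)
  have himg : P.image (fun γ => a (e γ)) = P := by
    refine Finset.eq_of_subset_of_card_le (Finset.image_subset_iff.mpr hmaps) ?_
    rw [Finset.card_image_of_injOn hinj]
  have hsum : ∑ γ ∈ P, f γ = ∑ γ ∈ P, f (a (e γ)) := by
    conv_lhs => rw [← himg]
    exact Finset.sum_image hinj
  have hset : {γ | γ ∈ ctx.Pos ∧ -(e γ) ∈ ctx.Pos} =
      (P.filter fun γ => -(e γ) ∈ ctx.Pos : Finset V) := by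
    ext; simp [hP]
  rw [hset, finsum_mem_coe_finset, Finset.sum_filter, hsum, ← Finset.sum_add_distrib]
  refine Finset.sum_congr rfl fun γ hγ => ?_
  have hγΔ := (he.map_mem_iff γ).mpr (ctx.pos_subset ((hP γ).mp hγ))
  by_cases h : e γ ∈ ctx.Pos
  · simp [a, h, ctx.pos_not_neg _ h]
  · simp only [a, h, ctx.neg_mem_pos hγΔ h, if_true, if_false, map_neg]; ring

end RootSystemCtx

/-- Theorem `uniq` 2: `N(w_μ⁻¹) = {γ ∈ Δ⁺ : (γ, μ∨) = −1}`,
and this set has `(ρ, θ∨ − μ∨)` elements. -/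
theorem statement_14 {V : Type*} [AddCommGroup V] [Module ℚ V] (ctx : RootSystemCtx V)
    (μ : V) (hμ : μ ∈ ctx.PosLong)
    (wμ : (V × ℚ × ℚ) ≃ₗ[ℚ] (V × ℚ × ℚ)) (hwμ : wμ ∈ ctx.Wfin)
    (hwθ : wμ (ctx.emb ctx.θ) = ctx.emb μ)
    (hminlen : ∀ u ∈ ctx.Wfin, u (ctx.emb ctx.θ) = ctx.emb μ →
      ctx.lenFin wμ ≤ ctx.lenFin u) :
    ctx.Nfin wμ⁻¹ = {γ | γ ∈ ctx.Pos ∧ ctx.B γ (ctx.coroot μ) = -1} ∧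
    (({γ | γ ∈ ctx.Pos ∧ ctx.B γ (ctx.coroot μ) = -1} : Set V).ncard : ℚ)
      = ctx.B ctx.ρ (ctx.coroot ctx.θ - ctx.coroot μ) := by
  obtain ⟨e, he, hwe⟩ := ctx.exists_isometry_of_mem_Wfin hwμ
  have heθ : e ctx.θ = μ := congrArg Prod.fst ((hwe _).symm.trans hwθ)
  have hB : ∀ γ, ctx.B (e.symm γ) ctx.θ = ctx.B γ μ := fun γ => by
    rw [← he.isometry, heθ, e.apply_symm_apply]
  have hN := ctx.Nfin_eq (ctx.inv_emb hwe)
  have key : ctx.Nfin wμ⁻¹ = {γ | γ ∈ ctx.Pos ∧ ctx.B γ (ctx.coroot μ) = -1} := by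
    rw [hN]
    ext γ
    refine and_congr_right fun hγ => ?_
    rw [ctx.B_coroot_eq_neg_one_iff hγ hμ]
    have hγΔ := ctx.pos_subset hγ
    refine ⟨fun hinv => ?_, fun h => ctx.neg_mem_pos ((he.symm.map_mem_iff γ).mpr hγΔ) fun hc => ?_⟩
    · have hle := ctx.theta_dominant hinv
      rw [map_neg, LinearMap.neg_apply, hB] at hle
      refine lt_of_le_of_ne (by linarith) fun h0 => ?_
      let s := ctx.refl (γ, 0, 0)
      have hs : s ∈ ctx.Wfin := Subgroup.subset_closure ⟨γ, hγΔ, rfl⟩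
      have hlen := hminlen (s * wμ) (mul_mem hs hwμ) (by
        rw [LinearEquiv.mul_apply, hwθ, ctx.refl_emb hγΔ, ctx.B_symm, h0]; simp)
      have hact : ∀ v, (s * wμ) (ctx.emb v) =
          ctx.emb (e (ctx.rootReflection (ctx.pos_subset hinv) v)) := fun v => by
        rw [LinearEquiv.mul_apply, hwe, ctx.refl_emb hγΔ, ctx.rootReflection_apply]
        have h1 : ctx.B v (e.symm γ) = ctx.B (e v) γ := by
          rw [← he.isometry, e.apply_symm_apply]
        have h2 := he.symm.isometry γ γ
        simp [h1, h2, neg_div]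
      rw [RootSystemCtx.lenFin, RootSystemCtx.lenFin, ctx.Nfin_eq hwe, ctx.Nfin_eq hact] at hlen
      exact absurd (ctx.ncard_inversions_lt he hinv (by simpa using hγ)) (not_lt.mpr hlen)
    · have := ctx.theta_dominant hc
      rw [hB] at this
      linarith
  refine ⟨key, ?_⟩
  have hcoroot : ∀ γ, ctx.B (e.symm γ) (ctx.coroot ctx.θ) = ctx.B γ (ctx.coroot μ) := fun γ => by
    rw [ctx.B_coroot, ctx.B_coroot, hB, hμ.2]
  have hsum := ctx.sum_pos_comp he.symm (ctx.B.flip (ctx.coroot ctx.θ))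
  rw [← hN, key] at hsum
  simp only [LinearMap.flip_apply, hcoroot] at hsum
  have hfin : {γ | γ ∈ ctx.Pos ∧ ctx.B γ (ctx.coroot μ) = -1}.Finite :=
    ctx.Δ_finite.subset fun _ h => ctx.pos_subset h.1
  have hcount : ∑ᶠ γ ∈ {γ | γ ∈ ctx.Pos ∧ ctx.B γ (ctx.coroot μ) = -1},
      2 * ctx.B γ (ctx.coroot μ) =
      -2 * ({γ | γ ∈ ctx.Pos ∧ ctx.B γ (ctx.coroot μ) = -1}.ncard : ℚ) := by
    rw [finsum_mem_congr rfl (g := fun _ => (-2 : ℚ)) fun γ hγ => by rw [hγ.2]; norm_num,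
      finsum_mem_eq_finite_toFinset_sum _ hfin, Finset.sum_const, nsmul_eq_mul,
      Set.ncard_eq_toFinset_card _ hfin, mul_comm]
  rw [hcount] at hsum
  simp only [RootSystemCtx.ρ, map_sub, map_smul, map_sum, LinearMap.smul_apply,
    LinearMap.sum_apply, smul_eq_mul]
  linarith
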